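/- (Weighted sum identity for the boundary values.) Write ψ_k*(λ,0) := conj(ψ_k(conj(λ),0)). For every λ ∈ ℂ with 0 < |λ| < a/3: ζ₃·ψ₂*(λ,0) + ζ₂·ψ₃*(λ,0) + ζ₁·ψ₁(λ,0) = −(iα/(3λ²))·(q̃₂(λ) − q̃₃(λ))·(q̃₂*(λ) − q̃₃*(λ)). -/

import Mathlib

open Complex

noncomputable def ζ₁ : ℂ := 1
noncomputable def ζ₂ : ℂ := (-1 + Real.sqrt 3 * Complex.I) / 2
noncomputable def ζ₃ : ℂ := (-1 - Real.sqrt 3 * Complex.I) / 2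

/-- `sfun p z = (1/3)·(ζ₁^(−p)·e^{zζ₁} + ζ₂^(−p)·e^{zζ₂} + ζ₃^(−p)·e^{zζ₃})`. -/
noncomputable def sfun (p : ℕ) (z : ℂ) : ℂ :=
  ((ζ₁ ^ p)⁻¹ * Complex.exp (z * ζ₁) + (ζ₂ ^ p)⁻¹ * Complex.exp (z * ζ₂) +
    (ζ₃ ^ p)⁻¹ * Complex.exp (z * ζ₃)) / 3

open MeasureTheory Set

/-- q̃ for direction ζ: `∫₀^∞ e^{−iλζx} q(x) dx`. -/
noncomputable def qt (q : ℝ → ℂ) (ζ lam : ℂ) : ℂ :=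
  ∫ x in Ioi (0:ℝ), Complex.exp (-Complex.I * lam * ζ * x) * q x

/-- Autocorrelation `g_q(s) = ∫₀^∞ q(x+s) conj(q(x)) dx`. -/
noncomputable def gq (q : ℝ → ℂ) (s : ℝ) : ℂ :=
  ∫ x in Ioi (0:ℝ), q (x + s) * (starRingEnd ℂ) (q x)

/-- `m_k(λ) = ∫₀^∞ e^{−iλζ_k s} g_q(s) ds`. -/
noncomputable def mker (q : ℝ → ℂ) (ζ lam : ℂ) : ℂ :=
  ∫ s in Ioi (0:ℝ), Complex.exp (-Complex.I * lam * ζ * s) * gq q s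

/-- `f*(λ) = conj (f (conj λ))`. -/
noncomputable def starF (f : ℂ → ℂ) (lam : ℂ) : ℂ :=
  (starRingEnd ℂ) (f ((starRingEnd ℂ) lam))

/-- `m_{s₀}(λ) = (m₁(λ)+m₂(λ)+m₃(λ))/3`. -/
noncomputable def ms0 (q : ℝ → ℂ) (lam : ℂ) : ℂ :=
  (mker q ζ₁ lam + mker q ζ₂ lam + mker q ζ₃ lam) / 3

/-- `m_{s₂}(λ) = (ζ₁m₁(λ)+ζ₂m₂(λ)+ζ₃m₃(λ))/(3(iλ)²)`. -/
noncomputable def ms2 (q : ℝ → ℂ) (lam : ℂ) : ℂ :=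
  (ζ₁ * mker q ζ₁ lam + ζ₂ * mker q ζ₂ lam + ζ₃ * mker q ζ₃ lam) /
    (3 * (Complex.I * lam) ^ 2)

/-- `b(λ) = 1 + iα m_{s₂}(λ)`. -/
noncomputable def bcoef (α : ℝ) (q : ℝ → ℂ) (lam : ℂ) : ℂ :=
  1 + Complex.I * α * ms2 q lam

/-- Generic Jost solution with oscillation direction `ζk` and coefficient direction `ζc`. -/
noncomputable def jost (α : ℝ) (q : ℝ → ℂ) (ζk ζc : ℂ) (lam : ℂ) (x : ℝ) : ℂ :=
  bcoef α q lam * Complex.exp (Complex.I * lam * ζk * x) -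
    Complex.I * α * starF (qt q ζc) lam *
      ∫ t in Ioi x, sfun 2 (Complex.I * lam * ((x : ℂ) - (t : ℂ))) / (Complex.I * lam) ^ 2 * q t

/-- `ψ₁(λ,x)`. -/
noncomputable def psi1 (α : ℝ) (q : ℝ → ℂ) (lam : ℂ) (x : ℝ) : ℂ := jost α q ζ₁ ζ₁ lam x

/-- `ψ₂(λ,x)`. -/
noncomputable def psi2 (α : ℝ) (q : ℝ → ℂ) (lam : ℂ) (x : ℝ) : ℂ := jost α q ζ₂ ζ₃ lam x

/-- `ψ₃(λ,x)`. -/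
noncomputable def psi3 (α : ℝ) (q : ℝ → ℂ) (lam : ℂ) (x : ℝ) : ℂ := jost α q ζ₃ ζ₂ lam x

/-- The integral of the correlation of two integrable functions on the half line splits into its
positive and negative lags. -/
theorem integral_Ioi_mul_integral_Ioi_eq_add {f g : ℝ → ℂ} (hf : IntegrableOn f (Ioi 0))
    (hg : IntegrableOn g (Ioi 0)) :
    (∫ x in Ioi (0:ℝ), f x) * ∫ x in Ioi (0:ℝ), g x =
      (∫ s in Ioi (0:ℝ), ∫ x in Ioi (0:ℝ), f (x + s) * g x) +
        ∫ s in Ioi (0:ℝ), ∫ x in Ioi (0:ℝ), f x * g (x + s) := by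
  set F := (Ioi (0:ℝ)).indicator f with hF
  set G := (Ioi (0:ℝ)).indicator g with hG
  have hFi : Integrable F := (integrable_indicator_iff measurableSet_Ioi).2 hf
  have hGi : Integrable G := (integrable_indicator_iff measurableSet_Ioi).2 hg
  have hGneg : Integrable (fun x => G (-x)) := hGi.comp_neg
  set K : ℝ → ℂ := fun s => ∫ x, F (x + s) * G x with hK
  have hconv : MeasureTheory.convolution (fun x => G (-x)) F (ContinuousLinearMap.mul ℝ ℂ)
      volume = K := by
    funext s
    rw [convolution_def, ← integral_neg_eq_self]
    simp [hK, mul_comm, add_comm]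
  have hKi : Integrable K := by
    rw [← hconv]
    exact hGneg.integrable_convolution _ hFi
  have hKint : ∫ s, K s = (∫ x, F x) * ∫ x, G x := by
    rw [← hconv, integral_convolution _ hGneg hFi, integral_neg_eq_self]
    simp [mul_comm]
  have hpos : ∀ s ∈ Ioi (0:ℝ), K s = ∫ x in Ioi (0:ℝ), f (x + s) * g x := by
    intro s hs
    rw [← integral_indicator measurableSet_Ioi]
    refine integral_congr_ae (.of_forall fun x => ?_)
    dsimp only
    by_cases hx : x ∈ Ioi (0:ℝ)
    · have : x + s ∈ Ioi (0:ℝ) := mem_Ioi.2 (add_pos (mem_Ioi.1 hx) (mem_Ioi.1 hs))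
      simp only [hF, hG, indicator_of_mem hx, indicator_of_mem this]
    · simp only [hG, indicator_of_notMem hx, mul_zero]
  have hneg : ∀ s ∈ Ioi (0:ℝ), K (-s) = ∫ x in Ioi (0:ℝ), f x * g (x + s) := by
    intro s hs
    rw [← integral_indicator measurableSet_Ioi, hK]
    simp only
    rw [← integral_add_right_eq_self _ s]
    refine integral_congr_ae (.of_forall fun x => ?_)
    dsimp only
    by_cases hx : x ∈ Ioi (0:ℝ)
    · have : x + s ∈ Ioi (0:ℝ) := mem_Ioi.2 (add_pos (mem_Ioi.1 hx) (mem_Ioi.1 hs))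
      simp only [hF, hG, add_neg_cancel_right, indicator_of_mem hx, indicator_of_mem this]
    · simp only [hF, add_neg_cancel_right, indicator_of_notMem hx, zero_mul]
  rw [← integral_indicator measurableSet_Ioi, ← integral_indicator measurableSet_Ioi, ← hF, ← hG,
    ← hKint, ← setIntegral_congr_fun measurableSet_Ioi hpos,
    ← setIntegral_congr_fun measurableSet_Ioi hneg, integral_comp_neg_Ioi, neg_zero, add_comm,
    ← compl_Iic, integral_add_compl measurableSet_Iic hKi]

/-- Exponential moments of order below `a` exist for a function square integrable against
`exp (2 a x)`. -/
theorem integrableOn_cexp_mul {a : ℝ} {q : ℝ → ℂ} (hq : Measurable q)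
    (hint : IntegrableOn (fun x => Real.exp (2 * a * x) * ‖q x‖ ^ 2) (Ioi 0))
    {c : ℂ} (hc : ‖c‖ < a) : IntegrableOn (fun x : ℝ => Complex.exp (c * x) * q x) (Ioi 0) := by
  have hdecay : IntegrableOn (fun x => Real.exp (-(2 * (a - ‖c‖)) * x)) (Ioi 0) :=
    exp_neg_integrableOn_Ioi 0 (by linarith)
  refine (hint.add hdecay).mono' (by fun_prop) ?_
  filter_upwards [ae_restrict_mem measurableSet_Ioi] with x hx
  have hre : (c * x).re ≤ ‖c‖ * x := by
    simpa using mul_le_mul_of_nonneg_right (re_le_norm c) (le_of_lt hx)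
  have hu : Real.exp (2 * a * x) = Real.exp (a * x) ^ 2 := by
    rw [← Real.exp_nat_mul]; ring_nf
  have hv : Real.exp (-(2 * (a - ‖c‖)) * x) = Real.exp (-(a - ‖c‖) * x) ^ 2 := by
    rw [← Real.exp_nat_mul]; ring_nf
  have huv : Real.exp (‖c‖ * x) = Real.exp (a * x) * Real.exp (-(a - ‖c‖) * x) := by
    rw [← Real.exp_add]; ring_nf
  calc ‖Complex.exp (c * x) * q x‖ = Real.exp (c * x).re * ‖q x‖ := by
        rw [norm_mul, Complex.norm_exp]
    _ ≤ Real.exp (‖c‖ * x) * ‖q x‖ := by gcongr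
    _ ≤ Real.exp (2 * a * x) * ‖q x‖ ^ 2 + Real.exp (-(2 * (a - ‖c‖)) * x) := by
        rw [hu, hv, huv]
        nlinarith [sq_nonneg (Real.exp (a * x) * ‖q x‖ - Real.exp (-(a - ‖c‖) * x)),
          sq_nonneg (Real.exp (a * x) * ‖q x‖), sq_nonneg (Real.exp (-(a - ‖c‖) * x))]

theorem starF_qt_conj (q : ℝ → ℂ) (ζ lam : ℂ) :
    starF (qt q (starRingEnd ℂ ζ)) lam =
      ∫ x in Ioi (0:ℝ), Complex.exp (Complex.I * lam * ζ * x) * (starRingEnd ℂ) (q x) := by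
  simp only [starF, qt, ← integral_conj, map_mul, ← Complex.exp_conj, map_neg, conj_I,
    Complex.conj_conj, conj_ofReal, neg_neg]

theorem starF_mker_conj (q : ℝ → ℂ) (ζ lam : ℂ) :
    starF (mker q (starRingEnd ℂ ζ)) lam =
      ∫ s in Ioi (0:ℝ), Complex.exp (Complex.I * lam * ζ * s) *
        ∫ x in Ioi (0:ℝ), (starRingEnd ℂ) (q (x + s)) * q x := by
  simp only [starF, mker, gq, ← integral_conj, map_mul, ← Complex.exp_conj, map_neg, conj_I,
    Complex.conj_conj, conj_ofReal, neg_neg]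

theorem mker_add_starF_mker {a : ℝ} {q : ℝ → ℂ} (hq : Measurable q)
    (hint : IntegrableOn (fun x => Real.exp (2 * a * x) * ‖q x‖ ^ 2) (Ioi 0))
    {ζ lam : ℂ} (hc : ‖lam * ζ‖ < a) :
    mker q ζ lam + starF (mker q (starRingEnd ℂ ζ)) lam =
      qt q ζ lam * starF (qt q (starRingEnd ℂ ζ)) lam := by
  have hf := integrableOn_cexp_mul hq hint (c := -Complex.I * lam * ζ)
    (by simpa [mul_assoc] using hc)
  have hg := integrableOn_cexp_mul (q := fun x => (starRingEnd ℂ) (q x)) (a := a)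
    (by fun_prop) (by simpa using hint) (c := Complex.I * lam * ζ)
    (by simpa [mul_assoc] using hc)
  rw [starF_qt_conj, starF_mker_conj, qt, integral_Ioi_mul_integral_Ioi_eq_add hf hg]
  congr 1
  · refine setIntegral_congr_fun measurableSet_Ioi fun s _ => ?_
    simp only [gq, ← integral_const_mul]
    congr 1 with x
    have : Complex.exp (-Complex.I * lam * ζ * s) = Complex.exp (-Complex.I * lam * ζ * ↑(x + s)) *
        Complex.exp (Complex.I * lam * ζ * x) := by
      rw [← Complex.exp_add]; push_cast; ring_nf
    rw [this]; ring
  · refine setIntegral_congr_fun measurableSet_Ioi fun s _ => ?_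
    simp only [← integral_const_mul]
    congr 1 with x
    have : Complex.exp (Complex.I * lam * ζ * s) = Complex.exp (-Complex.I * lam * ζ * x) *
        Complex.exp (Complex.I * lam * ζ * ↑(x + s)) := by
      rw [← Complex.exp_add]; push_cast; ring_nf
    rw [this]; ring

theorem conj_ζ₁ : (starRingEnd ℂ) ζ₁ = ζ₁ := by simp [ζ₁]

theorem conj_ζ₂ : (starRingEnd ℂ) ζ₂ = ζ₃ := by
  simp [ζ₂, ζ₃, sub_eq_add_neg, map_ofNat]

theorem conj_ζ₃ : (starRingEnd ℂ) ζ₃ = ζ₂ := by rw [← conj_ζ₂, Complex.conj_conj]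

theorem ζ₂_add_ζ₃ : ζ₂ + ζ₃ = -1 := by simp only [ζ₂, ζ₃]; ring

theorem ζ₂_mul_ζ₃ : ζ₂ * ζ₃ = 1 := by
  have h : (Real.sqrt 3 : ℂ) ^ 2 = 3 := by
    rw [← ofReal_pow, Real.sq_sqrt (by norm_num)]; norm_num
  simp only [ζ₂, ζ₃]
  linear_combination (-(Real.sqrt 3 : ℂ) ^ 2 / 4) * Complex.I_sq + h / 4

theorem ζ₂_sq : ζ₂ ^ 2 = ζ₃ := by
  linear_combination ζ₂ * ζ₂_add_ζ₃ - ζ₂_add_ζ₃ - ζ₂_mul_ζ₃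

theorem ζ₃_sq : ζ₃ ^ 2 = ζ₂ := by
  linear_combination ζ₃ * ζ₂_add_ζ₃ - ζ₂_add_ζ₃ - ζ₂_mul_ζ₃

theorem norm_ζ₂ : ‖ζ₂‖ = 1 := by
  have h : ‖ζ₂‖ ^ 2 = 1 := by
    have := mul_conj' ζ₂
    rw [conj_ζ₂, ζ₂_mul_ζ₃] at this
    exact_mod_cast this.symm
  exact (pow_eq_one_iff_of_nonneg (norm_nonneg _) two_ne_zero).1 h

theorem norm_ζ₃ : ‖ζ₃‖ = 1 := by rw [← conj_ζ₂, norm_conj, norm_ζ₂]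

theorem sfun_two (z : ℂ) :
    sfun 2 z = (ζ₁ * Complex.exp (z * ζ₁) + ζ₂ * Complex.exp (z * ζ₂) +
      ζ₃ * Complex.exp (z * ζ₃)) / 3 := by
  have h2 : (ζ₃)⁻¹ = ζ₂ := (eq_inv_of_mul_eq_one_left ζ₂_mul_ζ₃).symm
  have h3 : (ζ₂)⁻¹ = ζ₃ := by rw [← h2, inv_inv]
  rw [sfun, ζ₂_sq, ζ₃_sq, h2, h3]
  simp [ζ₁]

/-- The boundary value at `0` of a Jost solution in terms of the transforms of `q`. -/
theorem jost_zero {a : ℝ} {q : ℝ → ℂ} (hq : Measurable q)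
    (hint : IntegrableOn (fun x => Real.exp (2 * a * x) * ‖q x‖ ^ 2) (Ioi 0))
    (α : ℝ) (ζk ζc : ℂ) {lam : ℂ} (hlam : ‖lam‖ < a) :
    jost α q ζk ζc lam 0 = bcoef α q lam - Complex.I * α * starF (qt q ζc) lam *
      ((ζ₁ * qt q ζ₁ lam + ζ₂ * qt q ζ₂ lam + ζ₃ * qt q ζ₃ lam) /
        (3 * (Complex.I * lam) ^ 2)) := by
  have hi (ζ : ℂ) (hζ : ‖ζ‖ = 1) := integrableOn_cexp_mul hq hint (c := -Complex.I * lam * ζ)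
    (by simpa [hζ] using hlam)
  have h1 := (hi ζ₁ (by simp [ζ₁])).const_mul ζ₁
  have h2 := (hi ζ₂ norm_ζ₂).const_mul ζ₂
  have h3 := (hi ζ₃ norm_ζ₃).const_mul ζ₃
  have key : ∫ t in Ioi (0:ℝ), sfun 2 (Complex.I * lam * (((0:ℝ) : ℂ) - (t : ℂ))) /
      (Complex.I * lam) ^ 2 * q t = (ζ₁ * qt q ζ₁ lam + ζ₂ * qt q ζ₂ lam + ζ₃ * qt q ζ₃ lam) /
        (3 * (Complex.I * lam) ^ 2) := by
    simp only [qt]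
    rw [← integral_const_mul, ← integral_const_mul, ← integral_const_mul, ← integral_add h1 h2,
      ← integral_add (h1.fun_add h2) h3, ← integral_div]
    congr 1 with t
    have he (ζ : ℂ) : Complex.I * lam * (((0:ℝ) : ℂ) - (t : ℂ)) * ζ =
        -Complex.I * lam * ζ * t := by push_cast; ring
    rw [sfun_two, he, he, he]
    simp only [div_eq_mul_inv, mul_inv]
    ring
  rw [jost, key]
  simp

theorem stmt19 (a : ℝ) (ha : 0 < a) (α : ℝ) (q : ℝ → ℂ) (hq : Measurable q)
    (hint : IntegrableOn (fun x => Real.exp (2 * a * x) * ‖q x‖ ^ 2) (Ioi 0))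
    (lam : ℂ) (h0 : lam ≠ 0) (hlam : ‖lam‖ < a / 3) :
    ζ₃ * starF (fun μ => psi2 α q μ 0) lam + ζ₂ * starF (fun μ => psi3 α q μ 0) lam +
        ζ₁ * psi1 α q lam 0 =
      -(Complex.I * α / (3 * lam ^ 2)) * (qt q ζ₂ lam - qt q ζ₃ lam) *
        (starF (qt q ζ₂) lam - starF (qt q ζ₃) lam) := by
  have hlam' : ‖lam‖ < a := by linarith [norm_nonneg lam]
  have hconj : ‖(starRingEnd ℂ) lam‖ < a := by rwa [norm_conj]
  have k1 := mker_add_starF_mker hq hint (ζ := ζ₁) (lam := lam) (by simpa [ζ₁] using hlam')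
  have k2 := mker_add_starF_mker hq hint (ζ := ζ₂) (lam := lam) (by simpa [norm_ζ₂] using hlam')
  have k3 := mker_add_starF_mker hq hint (ζ := ζ₃) (lam := lam) (by simpa [norm_ζ₃] using hlam')
  rw [conj_ζ₁] at k1
  rw [conj_ζ₂] at k2
  rw [conj_ζ₃] at k3
  simp only [psi1, psi2, psi3, jost_zero hq hint α _ _ hlam', bcoef, ms2]
  simp only [starF] at k1 k2 k3 ⊢
  simp only [jost_zero hq hint α _ _ hconj, bcoef, ms2, starF, map_sub, map_add, map_neg, map_mul, map_div₀,
    map_pow, map_one, map_ofNat, conj_I, conj_ofReal, conj_ζ₁, conj_ζ₂, conj_ζ₃,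
    Complex.conj_conj, mul_pow, I_sq]
  have hζ₁ : ζ₁ = 1 := rfl
  simp only [hζ₁] at *
  generalize (starRingEnd ℂ) (qt q 1 ((starRingEnd ℂ) lam)) = R₁ at *
  generalize (starRingEnd ℂ) (qt q ζ₂ ((starRingEnd ℂ) lam)) = R₂ at *
  generalize (starRingEnd ℂ) (qt q ζ₃ ((starRingEnd ℂ) lam)) = R₃ at *
  linear_combination (1 + Complex.I * α / (3 * lam ^ 2) *
      ((starRingEnd ℂ) (mker q 1 ((starRingEnd ℂ) lam)) +
        ζ₃ * (starRingEnd ℂ) (mker q ζ₂ ((starRingEnd ℂ) lam)) +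
        ζ₂ * (starRingEnd ℂ) (mker q ζ₃ ((starRingEnd ℂ) lam)))) * ζ₂_add_ζ₃ -
    Complex.I * α / (3 * lam ^ 2) * (k1 + ζ₂ * k2 + ζ₃ * k3 +
      R₂ * (qt q ζ₃ lam * (ζ₃_sq + ζ₂_add_ζ₃) + qt q ζ₂ lam * ζ₂_mul_ζ₃) +
      R₃ * (qt q ζ₂ lam * (ζ₂_sq + ζ₂_add_ζ₃) + qt q ζ₃ lam * ζ₂_mul_ζ₃))
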